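/- Let X, Y be mm-spaces with closed subgroups G ⊆ Aut(X), H ⊆ Aut(Y). If □((X,G),(Y,H)) = 0, then (X,G) and (Y,H) are equivariantly mm-isomorphic. (Together with symmetry and the triangle inequality, this shows that the equivariant box distance □ is a metric on the set of equivariant mm-isomorphism classes.) -/

import Mathlib

open MeasureTheory Metric Filter Set TopologicalSpace
open scoped ENNReal Topology

noncomputable section

/-- The Ky Fan distance between two maps with respect to a measure:
`inf { ε ≥ 0 | μ {ω | d(u ω, u' ω) > ε} ≤ ε }`. -/
def kyFan {Ω : Type*} [MeasurableSpace Ω] (μ : Measure Ω)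
    {Z : Type*} [PseudoMetricSpace Z] (u u' : Ω → Z) : ℝ :=
  sInf {ε : ℝ | 0 ≤ ε ∧ μ {ω | ε < dist (u ω) (u' ω)} ≤ ENNReal.ofReal ε}

/-- `g` is an automorphism of the mm-space `(X, d, μ)`: a bijective isometry
preserving the measure. -/
def IsAut {X : Type*} [MetricSpace X] [MeasurableSpace X] (μ : Measure X) (g : X → X) : Prop :=
  Isometry g ∧ Function.Bijective g ∧ Measure.map g μ = μ

/-- `G` is a subgroup of `Aut(X)` that is closed with respect to the Ky Fan metric
(equivalently, under convergence in `μ`-measure). -/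
def IsClosedAutSubgroup {X : Type*} [MetricSpace X] [MeasurableSpace X]
    (μ : Measure X) (G : Set (X → X)) : Prop :=
  (∀ g ∈ G, IsAut μ g) ∧ (id ∈ G) ∧ (∀ g ∈ G, ∀ g' ∈ G, g ∘ g' ∈ G) ∧
  (∀ g ∈ G, ∃ g' ∈ G, g' ∘ g = id ∧ g ∘ g' = id) ∧
  (∀ (gs : ℕ → X → X) (g : X → X), (∀ n, gs n ∈ G) → IsAut μ g →
    Tendsto (fun n => kyFan μ (gs n) g) atTop (𝓝 0) → g ∈ G)

/-- Couplings between two measures: measures on the product with the given marginals. -/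
def couplings {X Y : Type*} [MeasurableSpace X] [MeasurableSpace Y]
    (μ : Measure X) (ν : Measure Y) : Set (Measure (X × Y)) :=
  {π | π.map Prod.fst = μ ∧ π.map Prod.snd = ν}

/-- The support of a Borel measure: points all of whose open neighborhoods have
positive measure. -/
def msupport {Z : Type*} [TopologicalSpace Z] [MeasurableSpace Z] (π : Measure Z) : Set Z :=
  {z | ∀ U : Set Z, IsOpen U → z ∈ U → 0 < π U}

/-- `d^S(g,h) = sup_{((x₁,y₁),(x₂,y₂)) ∈ S × S} |d_X(g x₁, x₂) - d_Y(h y₁, y₂)|`,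
with value `0` for `S = ∅`. -/
def dS {X Y : Type*} [MetricSpace X] [MetricSpace Y]
    (S : Set (X × Y)) (g : X → X) (h : Y → Y) : ℝ≥0∞ :=
  ⨆ p ∈ S ×ˢ S, ENNReal.ofReal |dist (g p.1.1) p.2.1 - dist (h p.1.2) p.2.2|

/-- `d^π(g,h) = inf { max(1 - π S, d^S(g,h)) | S ⊆ supp π closed }`. -/
def dPi {X Y : Type*} [MetricSpace X] [MetricSpace Y] [MeasurableSpace X] [MeasurableSpace Y]
    (π : Measure (X × Y)) (g : X → X) (h : Y → Y) : ℝ≥0∞ :=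
  ⨅ S ∈ {S : Set (X × Y) | IsClosed S ∧ S ⊆ msupport π}, max (1 - π S) (dS S g h)

/-- `□^π((X,G),(Y,H))`: the Hausdorff distance between `G` and `H` w.r.t. `d^π`. -/
def boxPi {X Y : Type*} [MetricSpace X] [MetricSpace Y] [MeasurableSpace X] [MeasurableSpace Y]
    (π : Measure (X × Y)) (G : Set (X → X)) (H : Set (Y → Y)) : ℝ≥0∞ :=
  max (⨆ g ∈ G, ⨅ h ∈ H, dPi π g h) (⨆ h ∈ H, ⨅ g ∈ G, dPi π g h)

/-- The equivariant box distance `□((X,G),(Y,H)) = inf_{π ∈ Π(μ,ν)} □^π((X,G),(Y,H))`. -/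
def eqBox {X Y : Type*} [MetricSpace X] [MetricSpace Y] [MeasurableSpace X] [MeasurableSpace Y]
    (μ : Measure X) (ν : Measure Y) (G : Set (X → X)) (H : Set (Y → Y)) : ℝ≥0∞ :=
  ⨅ π ∈ couplings μ ν, boxPi π G H

/-- The set of real-valued 1-Lipschitz functions. -/
def Lip1 (X : Type*) [PseudoMetricSpace X] : Set (X → ℝ) := {f | LipschitzWith 1 f}

/-- `ρ^π_{g,h}(f,f') = max( d_KF^π(f∘p₁, f'∘p₂), d_KF^π(f∘g∘p₁, f'∘h∘p₂) )`. -/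
def rhoPair {X Y : Type*} [MetricSpace X] [MetricSpace Y] [MeasurableSpace X] [MeasurableSpace Y]
    (π : Measure (X × Y)) (g : X → X) (h : Y → Y) (f : X → ℝ) (f' : Y → ℝ) : ℝ :=
  max (kyFan π (fun p => f p.1) (fun p => f' p.2))
      (kyFan π (fun p => f (g p.1)) (fun p => f' (h p.2)))

/-- `ρ^π(g,h)`: the Hausdorff distance between `Lip₁(X)` and `Lip₁(Y)` w.r.t. `ρ^π_{g,h}`. -/
def rhoPi {X Y : Type*} [MetricSpace X] [MetricSpace Y] [MeasurableSpace X] [MeasurableSpace Y]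
    (π : Measure (X × Y)) (g : X → X) (h : Y → Y) : ℝ :=
  max (⨆ f ∈ Lip1 X, ⨅ f' ∈ Lip1 Y, rhoPair π g h f f')
      (⨆ f' ∈ Lip1 Y, ⨅ f ∈ Lip1 X, rhoPair π g h f f')

/-- `d_conc^π((X,G),(Y,H))`: the Hausdorff distance between `G` and `H` w.r.t. `ρ^π`. -/
def dconcPi {X Y : Type*} [MetricSpace X] [MetricSpace Y] [MeasurableSpace X] [MeasurableSpace Y]
    (π : Measure (X × Y)) (G : Set (X → X)) (H : Set (Y → Y)) : ℝ :=
  max (⨆ g ∈ G, ⨅ h ∈ H, rhoPi π g h) (⨆ h ∈ H, ⨅ g ∈ G, rhoPi π g h)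

/-- The equivariant observable distance
`d_conc((X,G),(Y,H)) = inf_{π ∈ Π(μ,ν)} d_conc^π((X,G),(Y,H))`. -/
def eqDconc {X Y : Type*} [MetricSpace X] [MetricSpace Y] [MeasurableSpace X] [MeasurableSpace Y]
    (μ : Measure X) (ν : Measure Y) (G : Set (X → X)) (H : Set (Y → Y)) : ℝ :=
  ⨅ π ∈ couplings μ ν, dconcPi π G H

/-- `(X,G)` and `(Y,H)` are equivariantly mm-isomorphic: there is a measure-preserving
bijective isometry `φ : X → Y` equivariant with respect to a group isomorphism `G → H`. -/
def EquivMMIso {X Y : Type*} [MetricSpace X] [MetricSpace Y] [MeasurableSpace X] [MeasurableSpace Y]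
    (μ : Measure X) (ν : Measure Y) (G : Set (X → X)) (H : Set (Y → Y)) : Prop :=
  ∃ φ : X → Y, Isometry φ ∧ Function.Bijective φ ∧ Measure.map φ μ = ν ∧
    ∃ ρ : (X → X) → (Y → Y), Set.BijOn ρ G H ∧
      (∀ g ∈ G, ∀ g' ∈ G, ρ (g ∘ g') = ρ g ∘ ρ g') ∧
      (∀ g ∈ G, ∀ x, φ (g x) = ρ g (φ x))

/-- The Prokhorov (Lévy–Prokhorov) distance between two Borel measures. -/
def prokhorov {X : Type*} [PseudoMetricSpace X] [MeasurableSpace X] (μ ν : Measure X) : ℝ :=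
  sInf {ε : ℝ | 0 < ε ∧ ∀ A : Set X, MeasurableSet A →
    μ A ≤ ν (Metric.thickening ε A) + ENNReal.ofReal ε ∧
    ν A ≤ μ (Metric.thickening ε A) + ENNReal.ofReal ε}

/-- The κ-observable diameter `ObsDiam(X;-κ) = sup_{f ∈ Lip₁(X)} diam(f_*μ; -κ)`. -/
def obsDiam {X : Type*} [MetricSpace X] [MeasurableSpace X] (μ : Measure X) (κ : ℝ) : ℝ≥0∞ :=
  ⨆ f ∈ Lip1 X,
    ⨅ A ∈ {A : Set ℝ | MeasurableSet A ∧ 1 - ENNReal.ofReal κ ≤ μ.map f A}, EMetric.diam A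

/-- Weak Hausdorff convergence of a sequence of (closed) subsets, with the
convention `d(x, ∅) = ∞` (via `EMetric.infEdist`). -/
def WeakHausTendsto {X : Type*} [MetricSpace X] (S : ℕ → Set X) (T : Set X) : Prop :=
  (∀ x ∈ T, Tendsto (fun n => EMetric.infEdist x (S n)) atTop (𝓝 0)) ∧
  (∀ x ∉ T, 0 < Filter.liminf (fun n => EMetric.infEdist x (S n)) atTop)


/-- Prokhorov compactness for couplings: a sequence of couplings of two Borel probability measures
on complete separable spaces has a subsequence converging weakly to a coupling. -/
theorem exists_subseq_tendsto_coupling {X Y : Type*}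
    [MetricSpace X] [CompleteSpace X] [SecondCountableTopology X] [MeasurableSpace X] [BorelSpace X]
    [MetricSpace Y] [CompleteSpace Y] [SecondCountableTopology Y] [MeasurableSpace Y] [BorelSpace Y]
    {μ : Measure X} [IsProbabilityMeasure μ] {ν : Measure Y} [IsProbabilityMeasure ν]
    (πs : ℕ → ProbabilityMeasure (X × Y)) (hπs : ∀ n, (πs n : Measure (X × Y)) ∈ couplings μ ν) :
    ∃ π : ProbabilityMeasure (X × Y), (π : Measure (X × Y)) ∈ couplings μ ν ∧
      ∃ φ : ℕ → ℕ, StrictMono φ ∧ Tendsto (πs ∘ φ) atTop (𝓝 π) := by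
  set K : Set (ProbabilityMeasure (X × Y)) := {π | (π : Measure (X × Y)) ∈ couplings μ ν}
  have htight : IsTightMeasureSet {(π : Measure (X × Y)) | π ∈ K} := by
    apply IsTightMeasureSet.prodMk
    · refine (isTightMeasureSet_singleton (μ := μ)).subset ?_
      rintro _ ⟨_, ⟨π, hπ, rfl⟩, rfl⟩
      exact hπ.1
    · refine (isTightMeasureSet_singleton (μ := ν)).subset ?_
      rintro _ ⟨_, ⟨π, hπ, rfl⟩, rfl⟩
      exact hπ.2
  have hclosed : IsClosed K := by
    have hfst := ProbabilityMeasure.continuous_map (Ω := X × Y) continuous_fst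
    have hsnd := ProbabilityMeasure.continuous_map (Ω := X × Y) continuous_snd
    convert (isClosed_eq hfst (continuous_const (y := ⟨μ, inferInstance⟩))).inter
      (isClosed_eq hsnd (continuous_const (y := ⟨ν, inferInstance⟩))) using 1
    ext π
    exact and_congr
      ⟨fun h => ProbabilityMeasure.toMeasure_injective h, fun h => congrArg (fun ρ => ρ.1) h⟩
      ⟨fun h => ProbabilityMeasure.toMeasure_injective h, fun h => congrArg (fun ρ => ρ.1) h⟩
  have hcomp : IsCompact K := by
    simpa [hclosed.closure_eq] using isCompact_closure_of_isTightMeasureSet htight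
  obtain ⟨π, hπ, φ, hφ, hlim⟩ := hcomp.tendsto_subseq hπs
  exact ⟨π, hπ, φ, hφ, hlim⟩

theorem isProbabilityMeasure_of_mem_couplings {X Y : Type*} [MeasurableSpace X] [MeasurableSpace Y]
    {μ : Measure X} [IsProbabilityMeasure μ] {ν : Measure Y} {π : Measure (X × Y)}
    (hπ : π ∈ couplings μ ν) : IsProbabilityMeasure π := by
  constructor
  have h : π.map Prod.fst univ = 1 := by rw [hπ.1]; exact measure_univ
  simpa [Measure.map_apply measurable_fst MeasurableSet.univ] using h

theorem abs_dist_sub_dist_le_of_dPi_lt {X Y : Type*}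
    [MetricSpace X] [MeasurableSpace X] [BorelSpace X] [SecondCountableTopology X]
    [MetricSpace Y] [MeasurableSpace Y] [BorelSpace Y]
    {π : Measure (X × Y)} [IsProbabilityMeasure π] {g : X → X} {h : Y → Y}
    (hg : Isometry g) (hh : Isometry h) {ε : ℝ} (hε : 0 ≤ ε) {z w : X × Y}
    (hd : dPi π g h < ENNReal.ofReal ε)
    (hz : dPi π g h < π (ball z ε)) (hw : dPi π g h < π (ball w ε)) :
    |dist (g z.1) w.1 - dist (h z.2) w.2| ≤ 5 * ε := by
  have hlt := lt_min hd (lt_min hz hw)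
  obtain ⟨S, hlt⟩ := iInf_lt_iff.1 hlt
  obtain ⟨⟨hS, -⟩, hlt⟩ := iInf_lt_iff.1 hlt
  simp only [max_lt_iff, lt_min_iff] at hlt
  obtain ⟨⟨-, hdS⟩, ⟨hSz, -⟩, ⟨hSw, -⟩⟩ := hlt
  have key : ∀ u : X × Y, 1 - π S < π (ball u ε) → ∃ p ∈ S, dist p u < ε := by
    intro u hu
    by_contra! hcon
    have hdisj : ball u ε ⊆ Sᶜ := fun p hp hpS => (hcon p hpS).not_gt hp
    refine hu.not_ge ((measure_mono hdisj).trans ?_)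
    rw [prob_compl_eq_one_sub hS.measurableSet]
  obtain ⟨p, hp, hpz⟩ := key z hSz
  obtain ⟨q, hq, hqw⟩ := key w hSw
  have hpq : |dist (g p.1) q.1 - dist (h p.2) q.2| ≤ ε := by
    rw [← ENNReal.ofReal_le_ofReal_iff hε]
    exact (le_iSup₂_of_le (f := fun (p : (X × Y) × X × Y) (_ : p ∈ S ×ˢ S) =>
      ENNReal.ofReal |dist (g p.1.1) p.2.1 - dist (h p.1.2) p.2.2|) (p, q) ⟨hp, hq⟩ le_rfl).trans
      hdS.le
  rw [Prod.dist_eq, max_lt_iff] at hpz hqw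
  have h1 : |dist (g z.1) w.1 - dist (g p.1) q.1| ≤ dist (g z.1) (g p.1) + dist w.1 q.1 := by
    simpa [Real.dist_eq] using dist_dist_dist_le (g z.1) w.1 (g p.1) q.1
  have h2 : |dist (h z.2) w.2 - dist (h p.2) q.2| ≤ dist (h z.2) (h p.2) + dist w.2 q.2 := by
    simpa [Real.dist_eq] using dist_dist_dist_le (h z.2) w.2 (h p.2) q.2
  rw [hg.dist_eq, dist_comm z.1, dist_comm w.1] at h1
  rw [hh.dist_eq, dist_comm z.2, dist_comm w.2] at h2
  rw [abs_le] at *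
  constructor <;> linarith [h1.1, h1.2, h2.1, h2.2, hpq.1, hpq.2, hpz.1, hpz.2, hqw.1, hqw.2]

/-- If couplings `πs n` converge weakly to `π` and `d^{πs n}(g n, h n) → 0`, then the distortion of
`(g n, h n)` at any two points of the support of `π` tends to `0`. -/
theorem tendsto_dist_sub_dist_of_tendsto_dPi {X Y : Type*}
    [MetricSpace X] [MeasurableSpace X] [BorelSpace X] [SecondCountableTopology X]
    [MetricSpace Y] [MeasurableSpace Y] [BorelSpace Y]
    {πs : ℕ → ProbabilityMeasure (X × Y)} {π : ProbabilityMeasure (X × Y)}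
    (hπ : Tendsto πs atTop (𝓝 π)) {g : ℕ → X → X} {h : ℕ → Y → Y}
    (hg : ∀ n, Isometry (g n)) (hh : ∀ n, Isometry (h n))
    (hd : Tendsto (fun n => dPi (πs n : Measure (X × Y)) (g n) (h n)) atTop (𝓝 0))
    {z w : X × Y} (hz : z ∈ (π : Measure (X × Y)).support)
    (hw : w ∈ (π : Measure (X × Y)).support) :
    Tendsto (fun n => dist (g n z.1) w.1 - dist (h n z.2) w.2) atTop (𝓝 0) := by
  have key : ∀ u ∈ (π : Measure (X × Y)).support, ∀ ε > 0, ∀ᶠ n in atTop,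
      dPi (πs n : Measure (X × Y)) (g n) (h n) < (πs n : Measure (X × Y)) (ball u ε) := by
    intro u hu ε hε
    obtain ⟨c, hc0, hc⟩ := exists_between
      ((Measure.mem_support_iff_forall u).1 hu _ (ball_mem_nhds u hε))
    have hlim := hc.trans_le (ProbabilityMeasure.le_liminf_measure_open_of_tendsto hπ isOpen_ball)
    filter_upwards [eventually_lt_of_lt_liminf hlim, hd.eventually_lt_const hc0] with n h1 h2
    exact h2.trans h1
  rw [Metric.tendsto_nhds]
  intro ε hε
  have hε' : 0 < ε / 6 := by positivity
  filter_upwards [key z hz _ hε', key w hw _ hε',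
    hd.eventually_lt_const (ENNReal.ofReal_pos.2 hε')] with n h1 h2 h3
  rw [Real.dist_eq, sub_zero]
  linarith [abs_dist_sub_dist_le_of_dPi_lt (hg n) (hh n) hε'.le h3 h1 h2]

theorem exists_dPi_lt_of_boxPi_lt_left {X Y : Type*} [MetricSpace X] [MetricSpace Y]
    [MeasurableSpace X] [MeasurableSpace Y] {π : Measure (X × Y)} {G : Set (X → X)}
    {H : Set (Y → Y)} {δ : ℝ≥0∞} (hδ : boxPi π G H < δ) {g : X → X} (hg : g ∈ G) :
    ∃ h ∈ H, dPi π g h < δ := by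
  have := (le_iSup₂_of_le (f := fun g (_ : g ∈ G) => ⨅ h ∈ H, dPi π g h) g hg le_rfl).trans_lt
    ((le_max_left _ _).trans_lt hδ)
  simpa [iInf_lt_iff] using this

theorem exists_dPi_lt_of_boxPi_lt_right {X Y : Type*} [MetricSpace X] [MetricSpace Y]
    [MeasurableSpace X] [MeasurableSpace Y] {π : Measure (X × Y)} {G : Set (X → X)}
    {H : Set (Y → Y)} {δ : ℝ≥0∞} (hδ : boxPi π G H < δ) {h : Y → Y} (hh : h ∈ H) :
    ∃ g ∈ G, dPi π g h < δ := by
  have := (le_iSup₂_of_le (f := fun h (_ : h ∈ H) => ⨅ g ∈ G, dPi π g h) h hh le_rfl).trans_lt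
    ((le_max_right _ _).trans_lt hδ)
  simpa [iInf_lt_iff] using this

theorem IsAut.conj {X Y : Type*} [MetricSpace X] [MeasurableSpace X] [BorelSpace X]
    [MetricSpace Y] [MeasurableSpace Y] [BorelSpace Y] {μ : Measure X} {ν : Measure Y}
    (e : X ≃ᵢ Y) (he : Measure.map e μ = ν) {g : X → X} (hg : IsAut μ g) :
    IsAut ν (e ∘ g ∘ e.symm) := by
  refine ⟨e.isometry.comp (hg.1.comp e.symm.isometry),
    e.bijective.comp (hg.2.1.comp e.symm.bijective), ?_⟩
  have hgm := hg.1.continuous.measurable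
  have hem := e.continuous.measurable
  have hem' := e.symm.continuous.measurable
  have hν : Measure.map e.symm ν = μ := by
    rw [← he, Measure.map_map hem' hem, e.symm_comp_self, Measure.map_id]
  rw [← Measure.map_map hem (hgm.comp hem'), ← Measure.map_map hgm hem', hν, hg.2.2, he]

/-- A closed group of automorphisms is closed under pointwise convergence. -/
theorem IsClosedAutSubgroup.mem_of_tendsto {X : Type*} [MetricSpace X] [MeasurableSpace X]
    [BorelSpace X] [SecondCountableTopology X] {μ : Measure X} [IsFiniteMeasure μ]
    {G : Set (X → X)} (hG : IsClosedAutSubgroup μ G) {gs : ℕ → X → X} {g : X → X}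
    (hgs : ∀ n, gs n ∈ G) (hg : IsAut μ g) (hlim : ∀ x, Tendsto (fun n => gs n x) atTop (𝓝 (g x))) :
    g ∈ G := by
  refine hG.2.2.2.2 gs g hgs hg ?_
  have hmeas : TendstoInMeasure μ gs atTop g := tendstoInMeasure_of_tendsto_ae
    (fun n => (hG.1 _ (hgs n)).1.continuous.aestronglyMeasurable) (ae_of_all _ hlim)
  have hnonneg : ∀ n, 0 ≤ kyFan μ (gs n) g := fun n => Real.sInf_nonneg fun ε hε => hε.1
  rw [Metric.tendsto_nhds]
  intro ε hε
  have hε' : 0 < ε / 2 := by positivity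
  rw [tendstoInMeasure_iff_dist] at hmeas
  filter_upwards [(hmeas _ hε').eventually_lt_const (ENNReal.ofReal_pos.2 hε')] with n hn
  rw [Real.dist_eq, sub_zero, abs_of_nonneg (hnonneg n)]
  have hle : kyFan μ (gs n) g ≤ ε / 2 := csInf_le ⟨0, fun ε hε => hε.1⟩
    ⟨hε'.le, (measure_mono fun x (hx : ε / 2 < _) => hx.le).trans hn.le⟩
  linarith

/-- A measure on `X × Y` with second marginal `ν`, supported on a set on which the distances of the
two coordinates agree, has support projecting onto `Y`. -/
theorem exists_mem_support_snd {X Y : Type*}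
    [MetricSpace X] [CompleteSpace X] [SecondCountableTopology X] [MeasurableSpace X] [BorelSpace X]
    [MetricSpace Y] [CompleteSpace Y] [SecondCountableTopology Y] [MeasurableSpace Y] [BorelSpace Y]
    {ν : Measure Y} [ν.IsOpenPosMeasure] {π : Measure (X × Y)} (hπ : π.map Prod.snd = ν)
    (hdist : ∀ z ∈ π.support, ∀ w ∈ π.support, dist z.1 w.1 = dist z.2 w.2) (y : Y) :
    ∃ x, (x, y) ∈ π.support := by
  have : CompleteSpace π.support := Measure.isClosed_support.completeSpace_coe
  have hiso : Isometry (fun z : π.support => z.1.2) := Isometry.of_dist_eq fun z w => by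
    rw [Subtype.dist_eq, Prod.dist_eq, hdist _ z.2 _ w.2, max_self]
  have hclosed := hiso.isClosedEmbedding.isClosed_range
  have hdense : Dense (range fun z : π.support => z.1.2) := by
    rw [dense_iff_inter_open]
    intro U hU hne
    have hpos : 0 < π (Prod.snd ⁻¹' U) := by
      rw [← Measure.map_apply measurable_snd hU.measurableSet, hπ]
      exact hU.measure_pos ν hne
    obtain ⟨z, hzU, hz⟩ := Measure.nonempty_inter_support_of_pos hpos
    exact ⟨z.2, hzU, ⟨z, hz⟩, rfl⟩
  have : y ∈ range fun z : π.support => z.1.2 := by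
    rw [← hclosed.closure_eq, hdense.closure_eq]
    trivial
  obtain ⟨⟨⟨x, y'⟩, hz⟩, rfl⟩ := this
  exact ⟨x, hz⟩

/-- The first-coordinate analogue of `exists_mem_support_snd`. -/
theorem exists_mem_support_fst {X Y : Type*}
    [MetricSpace X] [CompleteSpace X] [SecondCountableTopology X] [MeasurableSpace X] [BorelSpace X]
    [MetricSpace Y] [CompleteSpace Y] [SecondCountableTopology Y] [MeasurableSpace Y] [BorelSpace Y]
    {μ : Measure X} [μ.IsOpenPosMeasure] {π : Measure (X × Y)} (hπ : π.map Prod.fst = μ)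
    (hdist : ∀ z ∈ π.support, ∀ w ∈ π.support, dist z.1 w.1 = dist z.2 w.2) (x : X) :
    ∃ y, (x, y) ∈ π.support := by
  have : CompleteSpace π.support := Measure.isClosed_support.completeSpace_coe
  have hiso : Isometry (fun z : π.support => z.1.1) := Isometry.of_dist_eq fun z w => by
    rw [Subtype.dist_eq, Prod.dist_eq, hdist _ z.2 _ w.2, max_self]
  have hclosed := hiso.isClosedEmbedding.isClosed_range
  have hdense : Dense (range fun z : π.support => z.1.1) := by
    rw [dense_iff_inter_open]
    intro U hU hne
    have hpos : 0 < π (Prod.fst ⁻¹' U) := by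
      rw [← Measure.map_apply measurable_fst hU.measurableSet, hπ]
      exact hU.measure_pos μ hne
    obtain ⟨z, hzU, hz⟩ := Measure.nonempty_inter_support_of_pos hpos
    exact ⟨z.1, hzU, ⟨z, hz⟩, rfl⟩
  have : x ∈ range fun z : π.support => z.1.1 := by
    rw [← hclosed.closure_eq, hdense.closure_eq]
    trivial
  obtain ⟨⟨⟨x', y⟩, hz⟩, rfl⟩ := this
  exact ⟨y, hz⟩

/-- A coupling whose support preserves distances is induced by a measure-preserving isometry. -/
theorem exists_isometryEquiv_of_coupling {X Y : Type*}
    [MetricSpace X] [CompleteSpace X] [SecondCountableTopology X] [MeasurableSpace X] [BorelSpace X]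
    [MetricSpace Y] [CompleteSpace Y] [SecondCountableTopology Y] [MeasurableSpace Y] [BorelSpace Y]
    {μ : Measure X} [μ.IsOpenPosMeasure] {ν : Measure Y} [ν.IsOpenPosMeasure]
    {π : Measure (X × Y)} (hπ : π ∈ couplings μ ν)
    (hdist : ∀ z ∈ π.support, ∀ w ∈ π.support, dist z.1 w.1 = dist z.2 w.2) :
    ∃ e : X ≃ᵢ Y, Measure.map e μ = ν ∧ ∀ x, (x, e x) ∈ π.support := by
  choose φ hφ using exists_mem_support_fst hπ.1 hdist
  choose ψ hψ using exists_mem_support_snd hπ.2 hdist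
  have hφψ : ∀ y, φ (ψ y) = y := fun y => by
    rw [← dist_eq_zero, ← hdist _ (hφ (ψ y)) _ (hψ y), dist_self]
  let e : X ≃ᵢ Y := IsometryEquiv.mk' φ ψ hφψ
    (Isometry.of_dist_eq fun x x' => (hdist _ (hφ x) _ (hφ x')).symm)
  refine ⟨e, ?_, hφ⟩
  rw [← hπ.1, Measure.map_map e.continuous.measurable measurable_fst, ← hπ.2]
  refine Measure.map_congr ?_
  filter_upwards [Measure.support_mem_ae (μ := π)] with z hz
  have h := hdist _ (hφ z.1) z hz
  rw [dist_self] at h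
  exact dist_eq_zero.1 h.symm


/-- nondegeneracy of the equivariant box distance: if
`□((X,G),(Y,H)) = 0` then `(X,G)` and `(Y,H)` are equivariantly mm-isomorphic. -/
theorem stmt_10 {X Y : Type*} [MetricSpace X] [CompleteSpace X] [SeparableSpace X] [MeasurableSpace X] [BorelSpace X]
    (μX : Measure X) [IsProbabilityMeasure μX] [μX.IsOpenPosMeasure]
    [MetricSpace Y] [CompleteSpace Y] [SeparableSpace Y] [MeasurableSpace Y] [BorelSpace Y]
    (μY : Measure Y) [IsProbabilityMeasure μY] [μY.IsOpenPosMeasure]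
    (G : Set (X → X)) (hG : IsClosedAutSubgroup μX G)
    (H : Set (Y → Y)) (hH : IsClosedAutSubgroup μY H)
    (h0 : eqBox μX μY G H = 0) :
    EquivMMIso μX μY G H := by
  have : SecondCountableTopology X := UniformSpace.secondCountable_of_separable X
  have : SecondCountableTopology Y := UniformSpace.secondCountable_of_separable Y
  have hex : ∀ n : ℕ, ∃ π ∈ couplings μX μY, boxPi π G H < ((n : ℝ≥0∞) + 1)⁻¹ := by
    intro n
    have hpos : eqBox μX μY G H < ((n : ℝ≥0∞) + 1)⁻¹ := by
      rw [h0, ENNReal.inv_pos]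
      simp
    simpa [eqBox, iInf_lt_iff] using hpos
  choose π' hπ' hbox' using hex
  obtain ⟨π, hπ, φ, hφ, hlim⟩ := exists_subseq_tendsto_coupling
    (fun n => ⟨π' n, isProbabilityMeasure_of_mem_couplings (hπ' n)⟩) hπ'
  set πs : ℕ → ProbabilityMeasure (X × Y) :=
    fun n => ⟨π' (φ n), isProbabilityMeasure_of_mem_couplings (hπ' (φ n))⟩
  replace hlim : Tendsto πs atTop (𝓝 π) := hlim
  set δ : ℕ → ℝ≥0∞ := fun n => ((φ n : ℝ≥0∞) + 1)⁻¹
  have hbox : ∀ n, boxPi (πs n : Measure (X × Y)) G H < δ n := fun n => hbox' (φ n)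
  have hδ : Tendsto δ atTop (𝓝 0) := by
    have : Tendsto (fun n : ℕ => ((n : ℝ≥0∞) + 1)⁻¹) atTop (𝓝 0) := by
      simpa using (tendsto_add_atTop_iff_nat 1).2 ENNReal.tendsto_inv_nat_nhds_zero
    exact this.comp hφ.tendsto_atTop
  have approxG : ∀ g ∈ G, ∃ hs : ℕ → Y → Y, (∀ n, hs n ∈ H) ∧
      ∀ z ∈ (π : Measure (X × Y)).support, ∀ w ∈ (π : Measure (X × Y)).support,
        Tendsto (fun n => dist (g z.1) w.1 - dist (hs n z.2) w.2) atTop (𝓝 0) := by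
    intro g hg
    choose hs hsH hsd using fun n => exists_dPi_lt_of_boxPi_lt_left (hbox n) hg
    exact ⟨hs, hsH, fun z hz w hw => tendsto_dist_sub_dist_of_tendsto_dPi hlim
      (fun _ => (hG.1 g hg).1) (fun n => (hH.1 _ (hsH n)).1)
      (tendsto_of_tendsto_of_tendsto_of_le_of_le tendsto_const_nhds hδ (fun _ => zero_le)
        fun n => (hsd n).le) hz hw⟩
  have approxH : ∀ h ∈ H, ∃ gs : ℕ → X → X, (∀ n, gs n ∈ G) ∧
      ∀ z ∈ (π : Measure (X × Y)).support, ∀ w ∈ (π : Measure (X × Y)).support,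
        Tendsto (fun n => dist (gs n z.1) w.1 - dist (h z.2) w.2) atTop (𝓝 0) := by
    intro h hh
    choose gs gsG gsd using fun n => exists_dPi_lt_of_boxPi_lt_right (hbox n) hh
    exact ⟨gs, gsG, fun z hz w hw => tendsto_dist_sub_dist_of_tendsto_dPi hlim
      (fun n => (hG.1 _ (gsG n)).1) (fun _ => (hH.1 h hh).1)
      (tendsto_of_tendsto_of_tendsto_of_le_of_le tendsto_const_nhds hδ (fun _ => zero_le)
        fun n => (gsd n).le) hz hw⟩
  have hdist : ∀ z ∈ (π : Measure (X × Y)).support, ∀ w ∈ (π : Measure (X × Y)).support,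
      dist z.1 w.1 = dist z.2 w.2 := by
    intro z hz w hw
    obtain ⟨hs, -, hs_lim⟩ := approxG id hG.2.1
    have hself : Tendsto (fun n => hs n z.2) atTop (𝓝 z.2) := by
      rw [tendsto_iff_dist_tendsto_zero]
      simpa using (hs_lim z hz z hz).neg
    have h1 := hs_lim z hz w hw
    have h2 : Tendsto (fun n => dist (id z.1) w.1 - dist (hs n z.2) w.2) atTop
        (𝓝 (dist z.1 w.1 - dist z.2 w.2)) := tendsto_const_nhds.sub (hself.dist tendsto_const_nhds)
    exact sub_eq_zero.1 (tendsto_nhds_unique h2 h1)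
  obtain ⟨e, he, hesupp⟩ := exists_isometryEquiv_of_coupling hπ hdist
  have he' : Measure.map e.symm μY = μX := by
    rw [← he, Measure.map_map e.symm.continuous.measurable e.continuous.measurable,
      e.symm_comp_self, Measure.map_id]
  have hesupp' : ∀ y, (e.symm y, y) ∈ (π : Measure (X × Y)).support := fun y => by
    simpa using hesupp (e.symm y)
  have hGH : ∀ g ∈ G, e ∘ g ∘ e.symm ∈ H := by
    intro g hg
    obtain ⟨hs, hsH, hs_lim⟩ := approxG g hg
    refine hH.mem_of_tendsto hsH ((hG.1 g hg).conj e he) fun y => ?_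
    rw [tendsto_iff_dist_tendsto_zero]
    simpa using (hs_lim _ (hesupp' y) _ (hesupp (g (e.symm y)))).neg
  have hHG : ∀ h ∈ H, e.symm ∘ h ∘ e ∈ G := by
    intro h hh
    obtain ⟨gs, gsG, gs_lim⟩ := approxH h hh
    refine hG.mem_of_tendsto gsG ((hH.1 h hh).conj e.symm he') fun x => ?_
    rw [tendsto_iff_dist_tendsto_zero]
    simpa using gs_lim _ (hesupp x) _ (hesupp' (h (e x)))
  refine ⟨e, e.isometry, e.bijective, he, fun g => e ∘ g ∘ e.symm, ⟨hGH, ?_, ?_⟩, ?_, ?_⟩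
  · intro g _ g' _ hgg'
    funext x
    simpa using congrFun hgg' (e x)
  · intro h hh
    refine ⟨_, hHG h hh, ?_⟩
    funext y
    simp
  · intro g _ g' _
    funext y
    simp
  · intro g _ x
    simp

end
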